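/- Let a, ad : (ℕ →₀ ℝ) →ₗ[ℝ] (ℕ →₀ ℝ) be the linear maps determined on the standard basis (e_m)_{m∈ℕ} of finitely supported real sequences by a e_m = √m · e_{m-1} (with a e_0 = 0) and ad e_m = √(m+1) · e_{m+1}, and let N = ad ∘ a. Then for every n ≥ 1, a^n ∘ ad^n − ad^n ∘ a^n = ∑_{k=1}^{n} (k! · binomial(n,k)²) • (∏_{j=0}^{n-k-1} (N − j • id)) as linear endomorphisms of ℕ →₀ ℝ, where the product over an empty index range is the identity map. -/

import Mathlib

theorem descFactorial_add_self_eq_sum (m n : ℕ) :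
    (m + n).descFactorial n =
      ∑ k ∈ Finset.range (n + 1),
        k.factorial * n.choose k ^ 2 * m.descFactorial (n - k) := by
  rw [Nat.descFactorial_eq_factorial_mul_choose, add_comm m n, Nat.add_choose_eq,
    Finset.Nat.sum_antidiagonal_eq_sum_range_succ (fun i j => n.choose i * m.choose j),
    Finset.mul_sum]
  refine Finset.sum_congr rfl fun k hk => ?_
  rw [Nat.descFactorial_eq_factorial_mul_choose,
    ← Nat.choose_mul_factorial_mul_factorial (Finset.mem_range_succ_iff.mp hk)]
  ring

theorem annihilation_pow_single {a : Module.End ℝ (ℕ →₀ ℝ)}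
    (ha : ∀ m : ℕ, a (Finsupp.single m 1) = Real.sqrt m • Finsupp.single (m - 1) 1)
    (n m : ℕ) :
    (a ^ n) (Finsupp.single m 1) =
      Real.sqrt (m.descFactorial n) • Finsupp.single (m - n) 1 := by
  induction n with
  | zero => simp
  | succ n ih =>
    rw [pow_succ', Module.End.mul_apply, ih, map_smul, ha, smul_smul, Nat.descFactorial_succ,
      Nat.cast_mul, Real.sqrt_mul (Nat.cast_nonneg _), mul_comm, Nat.sub_sub]

theorem creation_pow_single {ad : Module.End ℝ (ℕ →₀ ℝ)}
    (had : ∀ m : ℕ, ad (Finsupp.single m 1) = Real.sqrt (m + 1) • Finsupp.single (m + 1) 1)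
    (n m : ℕ) :
    (ad ^ n) (Finsupp.single m 1) =
      Real.sqrt ((m + n).descFactorial n) • Finsupp.single (m + n) 1 := by
  induction n with
  | zero => simp
  | succ n ih =>
    rw [pow_succ', Module.End.mul_apply, ih, map_smul, had, smul_smul, ← add_assoc,
      Nat.succ_descFactorial_succ, Nat.cast_mul, Real.sqrt_mul (Nat.cast_nonneg _), mul_comm,
      Nat.cast_add_one]

theorem annihilation_pow_mul_creation_pow_single {a ad : Module.End ℝ (ℕ →₀ ℝ)}
    (ha : ∀ m : ℕ, a (Finsupp.single m 1) = Real.sqrt m • Finsupp.single (m - 1) 1)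
    (had : ∀ m : ℕ, ad (Finsupp.single m 1) = Real.sqrt (m + 1) • Finsupp.single (m + 1) 1)
    (n m : ℕ) :
    (a ^ n * ad ^ n) (Finsupp.single m 1) =
      ((m + n).descFactorial n : ℝ) • Finsupp.single m 1 := by
  rw [Module.End.mul_apply, creation_pow_single had, map_smul, annihilation_pow_single ha,
    smul_smul, Real.mul_self_sqrt (Nat.cast_nonneg _), Nat.add_sub_cancel]

theorem creation_pow_mul_annihilation_pow_single {a ad : Module.End ℝ (ℕ →₀ ℝ)}
    (ha : ∀ m : ℕ, a (Finsupp.single m 1) = Real.sqrt m • Finsupp.single (m - 1) 1)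
    (had : ∀ m : ℕ, ad (Finsupp.single m 1) = Real.sqrt (m + 1) • Finsupp.single (m + 1) 1)
    (n m : ℕ) :
    (ad ^ n * a ^ n) (Finsupp.single m 1) =
      (m.descFactorial n : ℝ) • Finsupp.single m 1 := by
  rw [Module.End.mul_apply, annihilation_pow_single ha, map_smul]
  rcases le_or_gt n m with h | h
  · rw [creation_pow_single had, Nat.sub_add_cancel h, smul_smul,
      Real.mul_self_sqrt (Nat.cast_nonneg _)]
  · simp [Nat.descFactorial_of_lt h]

theorem prod_sub_smul_one_apply_of_eigenvector {V : Type*} [AddCommGroup V] [Module ℝ V]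
    {N : Module.End ℝ V} {m : ℕ} {v : V} (hv : N v = (m : ℝ) • v) (r : ℕ) :
    ((List.range r).map fun j : ℕ => N - (j : ℝ) • (1 : Module.End ℝ V)).prod v =
      (m.descFactorial r : ℝ) • v := by
  induction r with
  | zero => simp
  | succ r ih =>
    rw [List.range_succ, List.map_append, List.prod_append, List.map_singleton,
      List.prod_singleton, Module.End.mul_apply, LinearMap.sub_apply, LinearMap.smul_apply,
      Module.End.one_apply, hv, ← sub_smul, map_smul, ih, smul_smul, Nat.descFactorial_succ,
      Nat.cast_mul]
    rcases le_or_gt r m with h | h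
    · rw [Nat.cast_sub h]
    · simp [Nat.descFactorial_of_lt h]

/-- With `a, ad` the annihilation/creation operators on `ℕ →₀ ℝ` and `N = ad ∘ a`
the number operator, the Cahill–Glauber closed form holds for every `n ≥ 1`:
`aⁿ ∘ adⁿ − adⁿ ∘ aⁿ = ∑_{k=1}^{n} (k! · C(n,k)²) • ∏_{j=0}^{n-k-1} (N − j • id)`,
where the empty product is the identity (the ordered product is taken in the
monoid of linear endomorphisms, whose multiplication is composition). -/
theorem cahill_glauber_operator_identity
    (a ad : Module.End ℝ (ℕ →₀ ℝ))
    (ha : ∀ m : ℕ, a (Finsupp.single m 1) = Real.sqrt m • Finsupp.single (m - 1) 1)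
    (had : ∀ m : ℕ, ad (Finsupp.single m 1) = Real.sqrt (m + 1) • Finsupp.single (m + 1) 1)
    (n : ℕ) (hn : 1 ≤ n) :
    a ^ n * ad ^ n - ad ^ n * a ^ n =
      ∑ k ∈ Finset.Icc 1 n,
        (k.factorial * (n.choose k) ^ 2) •
          ((List.range (n - k)).map fun j =>
            ad * a - (j : ℝ) • (1 : Module.End ℝ (ℕ →₀ ℝ))).prod := by
  refine Finsupp.lhom_ext' fun m => LinearMap.ext_ring ?_
  have hN : (ad * a) (Finsupp.single m 1) = (m : ℝ) • Finsupp.single m 1 := by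
    simpa using creation_pow_mul_annihilation_pow_single ha had 1 m
  simp only [LinearMap.comp_apply, Finsupp.lsingle_apply, LinearMap.sub_apply,
    LinearMap.sum_apply, LinearMap.smul_apply]
  rw [annihilation_pow_mul_creation_pow_single ha had,
    creation_pow_mul_annihilation_pow_single ha had]
  simp only [bind_pure_comp, List.map_eq_map, List.map_map, Function.comp_def,
    prod_sub_smul_one_apply_of_eigenvector hN, ← Nat.cast_smul_eq_nsmul ℝ, smul_smul]
  rw [← Finset.sum_smul, ← sub_smul, descFactorial_add_self_eq_sum, Finset.range_eq_Ico,
    Finset.sum_eq_sum_Ico_succ_bot n.succ_pos, zero_add, Nat.succ_eq_add_one, Finset.Ico_add_one_right_eq_Icc]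
  simp
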